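/- arXiv:1804.10798 — 7 statements merged into one kernel-verified Lean document; each statement's English description precedes it below -/
import Mathlib

section
/- (Proposition 1, learnable-operator branch: sufficient descent under the Relaxed Optimality Condition.) Let E be a real inner product space, let f : E → ℝ be differentiable with L-Lipschitz continuous gradient (L > 0), let g : E → ℝ be convex, let h : E → ℝ be differentiable and μ-strongly convex (μ > 0), and let λ > 0 satisfy λ ≤ μ/L. Let c satisfy 0 < c < μ/(2λ). Suppose x, u ∈ E and d ∈ E is a subgradient of g at u (i.e., g(z) ≥ g(u) + ⟨d, z − u⟩ for all z) such that ‖d + ∇f(u) + (1/λ)(∇h(u) − ∇h(x))‖ ≤ c‖u − x‖. Then f(u) + g(u) ≤ f(x) + g(x) − (μ/(2λ) − c)‖u − x‖². -/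
open RealInnerProductSpace

/-- Lower quadratic bound (descent lemma) for a function with `L`-Lipschitz gradient. -/
theorem add_inner_sub_le_of_lipschitz_gradient {E : Type*}
    [NormedAddCommGroup E] [InnerProductSpace ℝ E] {f : E → ℝ} {f' : E → E} {L : ℝ}
    (hf : ∀ x : E, HasFDerivAt f (innerSL ℝ (f' x)) x)
    (hlip : ∀ x y : E, ‖f' x - f' y‖ ≤ L * ‖x - y‖) (x y : E) :
    f x + ⟪f' x, y - x⟫ - L / 2 * ‖y - x‖ ^ 2 ≤ f y := by
  set v := y - x with hv
  have hline (t : ℝ) : HasDerivAt (fun t : ℝ => x + t • v) v t := by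
    simpa using ((hasDerivAt_id t).smul_const v).const_add x
  have hderiv (t : ℝ) : HasDerivAt
      (fun t : ℝ => f (x + t • v) - t * ⟪f' x, v⟫ + L / 2 * ‖v‖ ^ 2 * t ^ 2)
      (⟪f' (x + t • v), v⟫ - ⟪f' x, v⟫ + L * ‖v‖ ^ 2 * t) t := by
    have h1 : HasDerivAt (fun t : ℝ => f (x + t • v)) ⟪f' (x + t • v), v⟫ t := by
      exact (hf (x + t • v)).comp_hasDerivAt t (hline t)
    have h2 := (hasDerivAt_id t).mul_const ⟪f' x, v⟫
    have h3 := ((hasDerivAt_id t).pow 2).const_mul (L / 2 * ‖v‖ ^ 2)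
    refine ((h1.sub h2).add h3).congr_deriv ?_
    simp
    ring
  have hmono := monotoneOn_of_deriv_nonneg (convex_Icc (0 : ℝ) 1)
    (fun t _ => (hderiv t).continuousAt.continuousWithinAt)
    (fun t _ => (hderiv t).differentiableAt.differentiableWithinAt)
    (fun t ht => by
      rw [interior_Icc] at ht
      rw [(hderiv t).deriv, ← inner_sub_left]
      have hgrad : ‖f' (x + t • v) - f' x‖ ≤ L * (t * ‖v‖) := by
        simpa [norm_smul, abs_of_pos ht.1] using hlip (x + t • v) x
      have hinner := (abs_le.mp (abs_real_inner_le_norm (f' (x + t • v) - f' x) v)).1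
      nlinarith [mul_le_mul_of_nonneg_right hgrad (norm_nonneg v)])
  have h01 := hmono (Set.left_mem_Icc.mpr zero_le_one) (Set.right_mem_Icc.mpr zero_le_one)
    zero_le_one
  have hend : x + v = y := by simp [hv]
  simp only [zero_smul, one_smul, add_zero, hend] at h01
  linarith

/-- The gradient of a differentiable `μ`-strongly convex function is `μ`-strongly monotone. -/
theorem mul_norm_sub_sq_le_inner_gradient_sub {E : Type*}
    [NormedAddCommGroup E] [InnerProductSpace ℝ E] {h : E → ℝ} {h' : E → E} {μ : ℝ}
    (hh : ∀ x : E, HasFDerivAt h (innerSL ℝ (h' x)) x)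
    (hsc : ConvexOn ℝ Set.univ (fun x => h x - μ / 2 * ‖x‖ ^ 2)) (x y : E) :
    μ * ‖y - x‖ ^ 2 ≤ ⟪h' y - h' x, y - x⟫ := by
  set v := y - x with hv
  have hderiv (t : ℝ) : HasDerivAt
      (fun t : ℝ => h (AffineMap.lineMap x y t) - μ / 2 * ‖AffineMap.lineMap x y t‖ ^ 2)
      (⟪h' (AffineMap.lineMap x y t), v⟫ - μ * ⟪AffineMap.lineMap x y t, v⟫) t := by
    have hline : HasDerivAt (AffineMap.lineMap x y : ℝ → E) v t := AffineMap.hasDerivAt_lineMap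
    have h1 := (hh (AffineMap.lineMap x y t)).comp_hasDerivAt t hline
    refine (h1.sub (hline.norm_sq.const_mul (μ / 2))).congr_deriv ?_
    simp
    ring
  have hconv := hsc.comp_affineMap (AffineMap.lineMap x y : ℝ →ᵃ[ℝ] E)
  have h0 := hconv.le_slope_of_hasDerivAt (Set.mem_univ 0) (Set.mem_univ 1) zero_lt_one (hderiv 0)
  have h1 := hconv.slope_le_of_hasDerivAt (Set.mem_univ 0) (Set.mem_univ 1) zero_lt_one (hderiv 1)
  have h01 := h0.trans h1
  simp only [AffineMap.lineMap_apply_zero, AffineMap.lineMap_apply_one] at h01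
  have hnorm : ‖v‖ ^ 2 = ⟪y, v⟫ - ⟪x, v⟫ := by
    rw [← inner_sub_left, ← hv, real_inner_self_eq_norm_sq]
  rw [inner_sub_left, hnorm]
  linarith

/-- Proposition 1, learnable-operator branch: sufficient descent under the
Relaxed Optimality Condition. If `∇f` is `L`-Lipschitz, `g` is convex,
`h` is differentiable and `μ`-strongly convex, `0 < λ ≤ μ/L`, `0 < c < μ/(2λ)`,
and `u` satisfies the ROC `‖d + ∇f(u) + (1/λ)(∇h(u) − ∇h(x))‖ ≤ c‖u − x‖`
for some subgradient `d` of `g` at `u`, then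
`f(u) + g(u) ≤ f(x) + g(x) − (μ/(2λ) − c)‖u − x‖²`. -/
theorem roc_sufficient_descent {E : Type*}
    [NormedAddCommGroup E] [InnerProductSpace ℝ E]
    (f g h : E → ℝ) (f' h' : E → E) (L μ lam c : ℝ)
    (hL : 0 < L) (hμ : 0 < μ)
    (hfdiff : ∀ x : E, HasFDerivAt f (innerSL ℝ (f' x)) x)
    (hlip : ∀ x y : E, ‖f' x - f' y‖ ≤ L * ‖x - y‖)
    (hgconv : ConvexOn ℝ Set.univ g)
    (hhdiff : ∀ x : E, HasFDerivAt h (innerSL ℝ (h' x)) x)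
    (hsc : ConvexOn ℝ Set.univ (fun x => h x - μ / 2 * ‖x‖ ^ 2))
    (hlam0 : 0 < lam) (hlam : lam ≤ μ / L)
    (hc0 : 0 < c) (hc : c < μ / (2 * lam))
    (x u d : E)
    (hsubgrad : ∀ z : E, g u + ⟪d, z - u⟫ ≤ g z)
    (hroc : ‖d + f' u + (1 / lam) • (h' u - h' x)‖ ≤ c * ‖u - x‖) :
    f u + g u ≤ f x + g x - (μ / (2 * lam) - c) * ‖u - x‖ ^ 2 := by
  have hdesc := add_inner_sub_le_of_lipschitz_gradient hfdiff hlip u x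
  have hmono := mul_norm_sub_sq_le_inner_gradient_sub hhdiff hsc x u
  have hsub := hsubgrad x
  have herr : ⟪d + f' u + (1 / lam) • (h' u - h' x), u - x⟫ ≤ c * ‖u - x‖ * ‖u - x‖ :=
    (real_inner_le_norm _ _).trans (mul_le_mul_of_nonneg_right hroc (norm_nonneg _))
  rw [inner_add_left, inner_add_left, real_inner_smul_left] at herr
  rw [← neg_sub u x, inner_neg_right] at hsub hdesc
  rw [norm_neg] at hdesc
  have hscaled := mul_le_mul_of_nonneg_left hmono (one_div_pos.mpr hlam0).le
  have hLle : L ≤ μ / lam := by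
    rw [le_div_iff₀ hL] at hlam
    rw [le_div_iff₀ hlam0]
    linarith
  have hLsq := mul_le_mul_of_nonneg_right hLle (sq_nonneg ‖u - x‖)
  have hhalf : μ / (2 * lam) = μ / lam / 2 := by rw [mul_comm, div_div]
  have hassoc : 1 / lam * (μ * ‖u - x‖ ^ 2) = μ / lam * ‖u - x‖ ^ 2 := by ring
  rw [hassoc] at hscaled
  rw [hhalf]
  linarith
end

section
/- (Relative error bound for the proximal gradient step.) Let E be a real inner product space, let f : E → ℝ be differentiable with L-Lipschitz continuous gradient (L > 0), let g : E → ℝ be convex, and let ρ > 0. Fix x ∈ E and suppose u is a global minimizer of y ↦ g(y) + ⟨∇f(x), y − x⟩ + (1/(2ρ))‖y − x‖². Then the vector d := −∇f(x) − (1/ρ)(u − x) is a subgradient of g at u (i.e., g(z) ≥ g(u) + ⟨d, z − u⟩ for all z), and ‖d + ∇f(u)‖ ≤ (L + 1/ρ)‖u − x‖. -/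
open RealInnerProductSpace

/-- An affine function of `t` that is nonnegative on `(0, 1]` and has nonnegative slope is
nonnegative at `0`. -/
lemma nonneg_of_forall_nonneg_add_mul {a b : ℝ} (hb : 0 ≤ b)
    (h : ∀ t : ℝ, 0 < t → t ≤ 1 → 0 ≤ a + t * b) : 0 ≤ a := by
  by_contra! ha
  have hba : 0 < b - a := by linarith
  have ht := h (-a / (b - a)) (div_pos (by linarith) hba) ((div_le_one hba).2 (by linarith))
  have key : a + -a / (b - a) * b = -a ^ 2 / (b - a) := by
    field_simp
    ring
  rw [key] at ht
  exact absurd ht (not_le.2 (div_neg_of_neg_of_pos (by nlinarith) hba))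

/-- First-order optimality condition for the proximal problem: if `u` minimizes
`y ↦ g y + ⟪v, y - x⟫ + (1 / (2ρ)) ‖y - x‖²` with `g` convex, then `-v - (1 / ρ) • (u - x)` is
a subgradient of `g` at `u`. -/
lemma ConvexOn.subgradient_of_prox_min {E : Type*}
    [NormedAddCommGroup E] [InnerProductSpace ℝ E] {g : E → ℝ} (hg : ConvexOn ℝ Set.univ g)
    {ρ : ℝ} (hρ : 0 < ρ) {v x u : E}
    (hmin : ∀ y : E,
      g u + ⟪v, u - x⟫ + 1 / (2 * ρ) * ‖u - x‖ ^ 2 ≤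
        g y + ⟪v, y - x⟫ + 1 / (2 * ρ) * ‖y - x‖ ^ 2) (z : E) :
    g u + ⟪-v - (1 / ρ) • (u - x), z - u⟫ ≤ g z := by
  have key : 0 ≤ g z - g u + ⟪v, z - u⟫ + 1 / ρ * ⟪u - x, z - u⟫ := by
    refine nonneg_of_forall_nonneg_add_mul
      (b := 1 / (2 * ρ) * ‖z - u‖ ^ 2) (by positivity) fun t ht ht1 => ?_
    have hconv := hg.2 (Set.mem_univ u) (Set.mem_univ z) (sub_nonneg.2 ht1) ht.le (by ring)
    have hm := hmin ((1 - t) • u + t • z)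
    have hy : (1 - t) • u + t • z - x = (u - x) + t • (z - u) := by module
    rw [hy, inner_add_right, norm_add_sq_real, real_inner_smul_right, real_inner_smul_right,
      norm_smul, mul_pow, Real.norm_eq_abs, sq_abs] at hm
    simp only [smul_eq_mul] at hconv
    have hhalf : 1 / ρ = 2 * (1 / (2 * ρ)) := by field_simp
    rw [hhalf]
    refine nonneg_of_mul_nonneg_right ?_ ht
    linarith
  rw [inner_sub_left, inner_neg_left, real_inner_smul_left]
  linarith

/-- Relative error bound for the proximal gradient step. If `u` globally minimizes
`y ↦ g(y) + ⟪∇f(x), y − x⟫ + (1/(2ρ))‖y − x‖²`, then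
`d := −∇f(x) − (1/ρ)(u − x)` is a subgradient of `g` at `u` and
`‖d + ∇f(u)‖ ≤ (L + 1/ρ)‖u − x‖`. -/
theorem prox_grad_relative_error {E : Type*}
    [NormedAddCommGroup E] [InnerProductSpace ℝ E]
    (f g : E → ℝ) (f' : E → E) (L ρ : ℝ) (hL : 0 < L) (hρ : 0 < ρ)
    (hdiff : ∀ x : E, HasFDerivAt f (innerSL ℝ (f' x)) x)
    (hlip : ∀ x y : E, ‖f' x - f' y‖ ≤ L * ‖x - y‖)
    (hgconv : ConvexOn ℝ Set.univ g)
    (x u : E)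
    (hmin : ∀ y : E,
      g u + ⟪f' x, u - x⟫ + 1 / (2 * ρ) * ‖u - x‖ ^ 2 ≤
        g y + ⟪f' x, y - x⟫ + 1 / (2 * ρ) * ‖y - x‖ ^ 2) :
    (∀ z : E, g u + ⟪-f' x - (1 / ρ) • (u - x), z - u⟫ ≤ g z) ∧
      ‖(-f' x - (1 / ρ) • (u - x)) + f' u‖ ≤ (L + 1 / ρ) * ‖u - x‖ := by
  refine ⟨hgconv.subgradient_of_prox_min hρ hmin, ?_⟩
  calc ‖(-f' x - (1 / ρ) • (u - x)) + f' u‖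
      = ‖(f' u - f' x) - (1 / ρ) • (u - x)‖ := by congr 1; abel
    _ ≤ ‖f' u - f' x‖ + ‖(1 / ρ) • (u - x)‖ := norm_sub_le _ _
    _ ≤ L * ‖u - x‖ + 1 / ρ * ‖u - x‖ := by
      rw [norm_smul, Real.norm_of_nonneg (by positivity)]
      gcongr
      exact hlip u x
    _ = (L + 1 / ρ) * ‖u - x‖ := by ring
end

section
/- (Theorem 1, criticality of accumulation points.) Let D be a positive natural number, let f : ℝ^D → ℝ (Euclidean space) be differentiable with continuous gradient ∇f, let g : ℝ^D → ℝ be convex, and let c ≥ 0. Suppose (u^j)_{j∈ℕ}, (x^j)_{j∈ℕ} are sequences both converging to a point x*, and (d^j)_{j∈ℕ} is a sequence such that for every j, d^j is a subgradient of g at u^j (i.e., g(z) ≥ g(u^j) + ⟨d^j, z − u^j⟩ for all z) and ‖d^j + ∇f(u^j)‖ ≤ c‖u^j − x^j‖. Then −∇f(x*) is a subgradient of g at x*; in particular 0 belongs to ∇f(x*) + ∂g(x*), i.e., x* is a critical point of Ψ = f + g. -/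
open Filter RealInnerProductSpace

/-- The graph of the subdifferential of a continuous function is closed. -/
theorem subgradient_of_tendsto {E : Type*} [NormedAddCommGroup E] [InnerProductSpace ℝ E]
    {g : E → ℝ} {u d : ℕ → E} {a v : E} (hg : ContinuousAt g a)
    (hu : Tendsto u atTop (nhds a)) (hd : Tendsto d atTop (nhds v))
    (hsub : ∀ (j : ℕ) (z : E), g (u j) + ⟪d j, z - u j⟫ ≤ g z) (z : E) :
    g a + ⟪v, z - a⟫ ≤ g z :=
  le_of_tendsto' ((hg.tendsto.comp hu).add (hd.inner (tendsto_const_nhds.sub hu)))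
    fun j => hsub j z

/-- Theorem 1, criticality of accumulation points: if `u^j → x*`, `x^j → x*`,
each `d^j` is a subgradient of the convex function `g` at `u^j`, and
`‖d^j + ∇f(u^j)‖ ≤ c‖u^j − x^j‖`, then `−∇f(x*)` is a subgradient of `g` at `x*`,
i.e. `x*` is a critical point of `Ψ = f + g`. -/
theorem accumulation_point_critical {D : ℕ} (hD : 0 < D)
    (f g : EuclideanSpace ℝ (Fin D) → ℝ)
    (hfdiff : Differentiable ℝ f)
    (hfgrad : Continuous (gradient f))
    (hgconv : ConvexOn ℝ Set.univ g)
    (c : ℝ) (hc : 0 ≤ c)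
    (u x d : ℕ → EuclideanSpace ℝ (Fin D))
    (xstar : EuclideanSpace ℝ (Fin D))
    (hu : Tendsto u atTop (nhds xstar))
    (hx : Tendsto x atTop (nhds xstar))
    (hsubgrad : ∀ (j : ℕ) (z : EuclideanSpace ℝ (Fin D)),
      g (u j) + ⟪d j, z - u j⟫ ≤ g z)
    (herr : ∀ j : ℕ, ‖d j + gradient f (u j)‖ ≤ c * ‖u j - x j‖) :
    ∀ z : EuclideanSpace ℝ (Fin D),
      g xstar + ⟪-gradient f xstar, z - xstar⟫ ≤ g z := by
  have hres : Tendsto (fun j => d j + gradient f (u j)) atTop (nhds 0) := by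
    refine squeeze_zero_norm herr ?_
    simpa using (hu.sub hx).norm.const_mul c
  have hd : Tendsto d atTop (nhds (-gradient f xstar)) := by
    simpa using hres.sub ((hfgrad.tendsto xstar).comp hu)
  have hg : ContinuousAt g xstar :=
    (hgconv.continuousOn isOpen_univ).continuousAt univ_mem
  exact subgradient_of_tendsto hg hu hd hsubgrad
end

section
/- (Theorem 1, global convergence under the Kurdyka–Łojasiewicz property: finite length and Cauchy sequence.) Let D be a positive natural number and let Ψ : ℝ^D → ℝ (Euclidean space) be differentiable with continuous gradient ∇Ψ. Let (x^t)_{t∈ℕ} be a sequence and a > 0, b > 0 constants such that for all t: (H1) Ψ(x^{t+1}) + a‖x^{t+1} − x^t‖² ≤ Ψ(x^t), and (H2) ‖∇Ψ(x^{t+1})‖ ≤ b‖x^{t+1} − x^t‖. Suppose x* is a cluster point of (x^t) (there is a strictly increasing map j ↦ t_j with x^{t_j} → x*), and Ψ satisfies the Kurdyka–Łojasiewicz inequality at x* with power desingularizer: there exist K > 0, θ ∈ (0,1], ε > 0 and η > 0 such that for all x with ‖x − x*‖ < ε and Ψ(x*) < Ψ(x) < Ψ(x*) + η, one has K·(Ψ(x)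 − Ψ(x*))^{θ−1}·‖∇Ψ(x)‖ ≥ 1. Then the sequence has finite length, ∑_{t=0}^{∞} ‖x^{t+1} − x^t‖ < ∞; in particular (x^t) is a Cauchy sequence, x^t converges to x*, and ∇Ψ(x*) = 0. -/
open Filter

/-- Tangent-line bound for the concave function `s ↦ s ^ θ`. -/
theorem Real.rpow_le_rpow_add_mul_sub {r s θ : ℝ} (hr : 0 < r) (hs : 0 ≤ s)
    (hθ0 : 0 ≤ θ) (hθ1 : θ ≤ 1) : s ^ θ ≤ r ^ θ + θ * r ^ (θ - 1) * (s - r) := by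
  have hsr : 1 + (s - r) / r = s / r := by field_simp; ring
  have h := rpow_one_add_le_one_add_mul_self (s := (s - r) / r)
    (by linarith [div_nonneg hs hr.le]) hθ0 hθ1
  rw [hsr, Real.div_rpow hs hr.le, div_le_iff₀ (Real.rpow_pos_of_pos hr θ)] at h
  rw [Real.rpow_sub_one hr.ne']
  calc s ^ θ ≤ _ := h
    _ = _ := by field_simp

/-- If the steps of a sequence satisfy a contraction inequality, up to the decrease of a
nonnegative sequence tending to zero, whenever the sequence is close to one of its cluster
points, then the sequence has finite length. -/
theorem summable_norm_sub_of_cluster {E : Type*} [NormedAddCommGroup E] {x : ℕ → E} {z : E}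
    {φ : ℕ → ℕ} (hφ : StrictMono φ) (hcluster : Tendsto (x ∘ φ) atTop (nhds z))
    {P : ℕ → ℝ} (hP0 : ∀ t, 0 ≤ P t) (hP : Tendsto P atTop (nhds 0))
    (hd : Tendsto (fun t => ‖x (t + 1) - x t‖) atTop (nhds 0)) {ε : ℝ} (hε : 0 < ε)
    (hstep : ∀ᶠ t in atTop, ‖x (t + 1) - z‖ < ε →
      2 * ‖x (t + 2) - x (t + 1)‖ ≤ ‖x (t + 1) - x t‖ + (P (t + 1) - P (t + 2))) :
    Summable (fun t => ‖x (t + 1) - x t‖) := by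
  obtain ⟨N, hN⟩ := eventually_atTop.1 hstep
  have hε4 : 0 < ε / 4 := by positivity
  have hclose : ∀ᶠ j in atTop, ‖x (φ j) - z‖ < ε / 4 := by
    filter_upwards [hcluster.eventually (Metric.ball_mem_nhds z hε4)] with j hj
    simpa [dist_eq_norm] using hj
  have hsmall : ∀ᶠ t in atTop, ‖x (t + 1) - x t‖ < ε / 4 ∧ P (t + 1) < ε / 4 ∧ N ≤ t :=
    (hd.eventually_lt_const hε4).and
      ((((tendsto_add_atTop_iff_nat 1).2 hP).eventually_lt_const hε4).and (eventually_ge_atTop N))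
  obtain ⟨j, hxj, hdj, hPj, hNj⟩ := (hclose.and (hφ.tendsto_atTop.eventually hsmall)).exists
  set T := φ j
  have hdist : ∀ n, ‖x (T + n) - x T‖ ≤
      ∑ i ∈ Finset.range n, ‖x (T + i + 1) - x (T + i)‖ := by
    intro n
    have := norm_sum_le (Finset.range n) (fun i => x (T + i + 1) - x (T + i))
    simp only [add_assoc] at this ⊢
    rwa [Finset.sum_range_sub (fun i => x (T + i))] at this
  have key : ∀ n, ∑ i ∈ Finset.range (n + 1), ‖x (T + i + 1) - x (T + i)‖
      + ‖x (T + n + 1) - x (T + n)‖ + P (T + n + 1) ≤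
        2 * ‖x (T + 1) - x T‖ + P (T + 1) := by
    intro n
    induction n with
    | zero => simp; linarith
    | succ n ih =>
      have hball : ‖x (T + n + 1) - z‖ < ε := by
        have h1 := hdist (n + 1)
        have h2 := norm_sub_le_norm_sub_add_norm_sub (x (T + n + 1)) (x T) z
        have h3 := hP0 (T + n + 1)
        have h4 := norm_nonneg (x (T + n + 1) - x (T + n))
        rw [← add_assoc] at h1
        linarith
      have h := hN (T + n) (by omega) hball
      rw [Finset.sum_range_succ]
      simp only [← add_assoc] at h ⊢
      simp only [add_assoc, Nat.reduceAdd] at h ih ⊢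
      linarith
  refine (summable_nat_add_iff T).1 (summable_of_sum_range_le
    (c := 2 * ‖x (T + 1) - x T‖ + P (T + 1)) (fun _ => norm_nonneg _) fun n => ?_)
  have h1 := key n
  rw [Finset.sum_range_succ] at h1
  have h2 := hP0 (T + n + 1)
  have h3 := norm_nonneg (x (T + n + 1) - x (T + n))
  simp only [add_comm _ T]
  linarith

/-- Theorem 1, global convergence under the Kurdyka–Łojasiewicz property: under the
sufficient-decrease (H1) and relative-error (H2) conditions, if `x*` is a cluster
point of `(x^t)` and `Ψ` satisfies the KL inequality at `x*` with a power
desingularizer, then the sequence has finite length `∑ ‖x^{t+1} − x^t‖ < ∞`, hence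
is Cauchy, converges to `x*`, and `∇Ψ(x*) = 0`. -/
theorem kl_global_convergence {D : ℕ} (hD : 0 < D)
    (Ψ : EuclideanSpace ℝ (Fin D) → ℝ)
    (hdiff : Differentiable ℝ Ψ)
    (hgradcont : Continuous (gradient Ψ))
    (x : ℕ → EuclideanSpace ℝ (Fin D))
    (a b : ℝ) (ha : 0 < a) (hb : 0 < b)
    (H1 : ∀ t : ℕ, Ψ (x (t + 1)) + a * ‖x (t + 1) - x t‖ ^ 2 ≤ Ψ (x t))
    (H2 : ∀ t : ℕ, ‖gradient Ψ (x (t + 1))‖ ≤ b * ‖x (t + 1) - x t‖)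
    (xstar : EuclideanSpace ℝ (Fin D))
    (φ : ℕ → ℕ) (hφ : StrictMono φ)
    (hcluster : Tendsto (x ∘ φ) atTop (nhds xstar))
    (K θ ε η : ℝ) (hK : 0 < K) (hθ0 : 0 < θ) (hθ1 : θ ≤ 1) (hε : 0 < ε) (hη : 0 < η)
    (hKL : ∀ y : EuclideanSpace ℝ (Fin D), ‖y - xstar‖ < ε →
      Ψ xstar < Ψ y → Ψ y < Ψ xstar + η →
      1 ≤ K * (Ψ y - Ψ xstar) ^ (θ - 1) * ‖gradient Ψ y‖) :
    Summable (fun t : ℕ => ‖x (t + 1) - x t‖) ∧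
      CauchySeq x ∧
      Tendsto x atTop (nhds xstar) ∧
      gradient Ψ xstar = 0 := by
  have hΨc : Continuous Ψ := hdiff.continuous
  have hanti : Antitone (fun t => Ψ (x t)) :=
    antitone_nat_of_succ_le fun t => by
      have := H1 t
      have : 0 ≤ a * ‖x (t + 1) - x t‖ ^ 2 := by positivity
      linarith
  have hlim : Tendsto (fun t => Ψ (x t)) atTop (nhds (Ψ xstar)) :=
    (tendsto_iff_tendsto_subseq_of_antitone hanti hφ.tendsto_atTop).2
      ((hΨc.tendsto xstar).comp hcluster)
  have hge : ∀ t, Ψ xstar ≤ Ψ (x t) := fun t => hanti.le_of_tendsto hlim t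
  have hd : Tendsto (fun t => ‖x (t + 1) - x t‖) atTop (nhds 0) := by
    have hdiff0 : Tendsto (fun t => (Ψ (x t) - Ψ (x (t + 1))) / a) atTop (nhds 0) := by
      simpa using (hlim.sub ((tendsto_add_atTop_iff_nat 1).2 hlim)).div_const a
    have hsq : Tendsto (fun t => ‖x (t + 1) - x t‖ ^ 2) atTop (nhds 0) :=
      squeeze_zero (fun _ => by positivity)
        (fun t => by rw [le_div_iff₀ ha]; linarith [H1 t]) hdiff0
    simpa using hsq.sqrt
  have hr : Tendsto (fun t => Ψ (x t) - Ψ xstar) atTop (nhds 0) := by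
    simpa using hlim.sub_const (Ψ xstar)
  have hsum : Summable (fun t : ℕ => ‖x (t + 1) - x t‖) := by
    refine summable_norm_sub_of_cluster hφ hcluster
      (P := fun t => b / a * (K / θ * (Ψ (x t) - Ψ xstar) ^ θ))
      (fun t => ?_) ?_ hd hε ?_
    · have := Real.rpow_nonneg (sub_nonneg.2 (hge t)) θ
      positivity
    · have := hr.rpow_const (p := θ) (Or.inr hθ0.le)
      rw [Real.zero_rpow hθ0.ne'] at this
      simpa using (this.const_mul (K / θ)).const_mul (b / a)
    · filter_upwards [((tendsto_add_atTop_iff_nat 1).2 hr).eventually_lt_const hη] with t ht hball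
      have hdec := H1 (t + 1)
      have hs0 := sub_nonneg.2 (hge (t + 2))
      have hrs : Ψ (x (t + 2)) ≤ Ψ (x (t + 1)) := hanti (Nat.le_succ _)
      have hΔ0 : (Ψ (x (t + 2)) - Ψ xstar) ^ θ ≤ (Ψ (x (t + 1)) - Ψ xstar) ^ θ :=
        Real.rpow_le_rpow hs0 (by linarith) hθ0.le
      set d := ‖x (t + 2) - x (t + 1)‖
      set d' := ‖x (t + 1) - x t‖
      set e := b / a * (K / θ * (Ψ (x (t + 1)) - Ψ xstar) ^ θ)
        - b / a * (K / θ * (Ψ (x (t + 2)) - Ψ xstar) ^ θ) with he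
      have he' : e = b / a * (K / θ *
          ((Ψ (x (t + 1)) - Ψ xstar) ^ θ - (Ψ (x (t + 2)) - Ψ xstar) ^ θ)) := by
        rw [he]; ring
      have he0 : 0 ≤ e := by
        rw [he']
        have := sub_nonneg.2 hΔ0
        positivity
      have hd'0 : 0 ≤ d' := norm_nonneg _
      have hmul : d ^ 2 ≤ d' * e := by
        rcases (hge (t + 1)).eq_or_lt with h0 | hpos
        · have : a * d ^ 2 ≤ 0 := by linarith [hge (t + 2)]
          have : d ^ 2 ≤ 0 := nonpos_of_mul_nonpos_right this ha
          exact this.trans (mul_nonneg hd'0 he0)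
        · have hkl := hKL _ hball hpos (by linarith)
          have htan := Real.rpow_le_rpow_add_mul_sub (sub_pos.2 hpos) hs0 hθ0.le hθ1
          have hg := H2 t
          set r := Ψ (x (t + 1)) - Ψ xstar
          set s := Ψ (x (t + 2)) - Ψ xstar
          have hu0 : 0 ≤ K * r ^ (θ - 1) := by
            have := Real.rpow_nonneg (sub_pos.2 hpos).le (θ - 1)
            positivity
          have hkl' : 1 ≤ K * r ^ (θ - 1) * (b * d') :=
            hkl.trans (mul_le_mul_of_nonneg_left hg hu0)
          have hrs0 : 0 ≤ r - s := by simp only [r, s]; linarith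
          have hΔ : K * r ^ (θ - 1) * (r - s) ≤ K / θ * (r ^ θ - s ^ θ) := by
            rw [div_mul_eq_mul_div, le_div_iff₀ hθ0]
            nlinarith
          have hmain : a * d ^ 2 ≤ b * d' * (K / θ * (r ^ θ - s ^ θ)) :=
            calc a * d ^ 2 ≤ r - s := by simp only [r, s]; linarith
              _ ≤ (K * r ^ (θ - 1) * (b * d')) * (r - s) := le_mul_of_one_le_left hrs0 hkl'
              _ = b * d' * (K * r ^ (θ - 1) * (r - s)) := by ring
              _ ≤ _ := mul_le_mul_of_nonneg_left hΔ (by positivity)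
          rw [he']
          calc d ^ 2 ≤ b * d' * (K / θ * (r ^ θ - s ^ θ)) / a := by
                rw [le_div_iff₀ ha]; linarith
            _ = _ := by ring
      exact (le_abs_self _).trans (abs_le_of_sq_le_sq
        (by nlinarith [sq_nonneg (d' - e)]) (add_nonneg hd'0 he0))
  have hcauchy : CauchySeq x := cauchySeq_of_summable_dist <| by
    simpa only [dist_eq_norm, norm_sub_rev] using hsum
  have hconv : Tendsto x atTop (nhds xstar) :=
    tendsto_nhds_of_cauchySeq_of_subseq hcauchy hφ.tendsto_atTop hcluster
  refine ⟨hsum, hcauchy, hconv, ?_⟩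
  have hg0 : Tendsto (fun t => gradient Ψ (x (t + 1))) atTop (nhds 0) :=
    squeeze_zero_norm H2 (by simpa using hd.const_mul b)
  exact tendsto_nhds_unique
    ((hgradcont.tendsto xstar).comp ((tendsto_add_atTop_iff_nat 1).2 hconv)) hg0
end

section
/- (Corollary 1, case θ = 1: convergence in finitely many iterations.) Let D be a positive natural number and let Ψ : ℝ^D → ℝ (Euclidean space) be differentiable with continuous gradient ∇Ψ. Let (x^t)_{t∈ℕ} be a sequence and a > 0, b > 0 constants such that for all t: (H1) Ψ(x^{t+1}) + a‖x^{t+1} − x^t‖² ≤ Ψ(x^t), and (H2) ‖∇Ψ(x^{t+1})‖ ≤ b‖x^{t+1} − x^t‖. Suppose x* is a cluster point of (x^t), and Ψ satisfies the Kurdyka–Łojasiewicz inequality at x* with linear desingularizer: there exist K > 0, ε > 0 and η > 0 such that for all x with ‖x − x*‖ < ε and Ψ(x*) < Ψ(x) < Ψ(x*) + η, one has K·‖∇Ψ(x)‖ ≥ 1. Then the sequence converges after finitely many iterations: there exists T ∈ ℕ such that x^t = x^T for all t ≥ T, and x^T = x*. -/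
open Filter

/-- Corollary 1, case `θ = 1`: under (H1), (H2) and the KL inequality at a cluster
point `x*` with linear desingularizer (`K‖∇Ψ(x)‖ ≥ 1` near `x*`), the sequence
converges after finitely many iterations to `x*`. -/
theorem kl_finite_convergence {D : ℕ} (hD : 0 < D)
    (Ψ : EuclideanSpace ℝ (Fin D) → ℝ)
    (hdiff : Differentiable ℝ Ψ)
    (hgradcont : Continuous (gradient Ψ))
    (x : ℕ → EuclideanSpace ℝ (Fin D))
    (a b : ℝ) (ha : 0 < a) (hb : 0 < b)
    (H1 : ∀ t : ℕ, Ψ (x (t + 1)) + a * ‖x (t + 1) - x t‖ ^ 2 ≤ Ψ (x t))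
    (H2 : ∀ t : ℕ, ‖gradient Ψ (x (t + 1))‖ ≤ b * ‖x (t + 1) - x t‖)
    (xstar : EuclideanSpace ℝ (Fin D))
    (φ : ℕ → ℕ) (hφ : StrictMono φ)
    (hcluster : Tendsto (x ∘ φ) atTop (nhds xstar))
    (K ε η : ℝ) (hK : 0 < K) (hε : 0 < ε) (hη : 0 < η)
    (hKL : ∀ y : EuclideanSpace ℝ (Fin D), ‖y - xstar‖ < ε →
      Ψ xstar < Ψ y → Ψ y < Ψ xstar + η →
      1 ≤ K * ‖gradient Ψ y‖) :
    ∃ T : ℕ, (∀ t : ℕ, T ≤ t → x t = x T) ∧ x T = xstar := by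
  have hanti : Antitone (Ψ ∘ x) := antitone_nat_of_succ_le fun t => by
    have h := H1 t
    have h0 : 0 ≤ a * ‖x (t + 1) - x t‖ ^ 2 := by positivity
    simp only [Function.comp_apply]
    linarith
  have hlim : Tendsto (Ψ ∘ x) atTop (nhds (Ψ xstar)) :=
    (tendsto_iff_tendsto_subseq_of_antitone hanti hφ.tendsto_atTop).2
      ((hdiff.continuous.tendsto xstar).comp hcluster)
  have hge : ∀ t, Ψ xstar ≤ Ψ (x t) := fun t => hanti.le_of_tendsto hlim t
  -- The value `Ψ xstar` is attained: otherwise the KL inequality bounds the steps from below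
  -- along the subsequence, while sufficient decrease forces them to vanish.
  obtain ⟨T, hT⟩ : ∃ T, Ψ (x T) = Ψ xstar := by
    by_contra! hne
    have hgt : ∀ t, Ψ xstar < Ψ (x t) := fun t => lt_of_le_of_ne (hge t) (hne t).symm
    have hball : ∀ᶠ n in atTop, ‖x (φ n) - xstar‖ < ε := by
      simpa [dist_eq_norm] using hcluster.eventually (Metric.ball_mem_nhds xstar hε)
    have hstep : 0 < a * (1 / (K * b)) ^ 2 := by positivity
    have hval : ∀ᶠ t in atTop, Ψ (x t) < Ψ xstar + min η (a * (1 / (K * b)) ^ 2) :=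
      hlim.eventually_lt_const (lt_add_of_pos_right _ (lt_min hη hstep))
    obtain ⟨N, hN⟩ := eventually_atTop.1 hval
    obtain ⟨n, hn, hnN⟩ := (hball.and (hφ.tendsto_atTop.eventually_ge_atTop (N + 1))).exists
    obtain ⟨m, hm⟩ : ∃ m, φ n = m + 1 := ⟨φ n - 1, by omega⟩
    rw [hm] at hn hnN
    have hKLm := hKL _ hn (hgt _)
      ((hN (m + 1) (by omega)).trans_le (by gcongr; exact min_le_left _ _))
    have hlow : 1 / (K * b) ≤ ‖x (m + 1) - x m‖ := by
      rw [div_le_iff₀' (by positivity), mul_assoc]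
      exact hKLm.trans (mul_le_mul_of_nonneg_left (H2 m) hK.le)
    have hsq : a * (1 / (K * b)) ^ 2 ≤ a * ‖x (m + 1) - x m‖ ^ 2 := by gcongr
    have hm' := hN m (by omega)
    linarith [H1 m, hgt (m + 1), min_le_right η (a * (1 / (K * b)) ^ 2)]
  have hconst : ∀ t, T ≤ t → x t = x T := by
    intro t ht
    induction t, ht using Nat.le_induction with
    | base => rfl
    | succ t ht ih =>
      have h := H1 t
      rw [ih, hT] at h
      have hsq : ‖x (t + 1) - x T‖ ^ 2 ≤ 0 :=
        nonpos_of_mul_nonpos_right (by linarith [hge (t + 1)]) ha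
      exact sub_eq_zero.1 (norm_eq_zero.1 (pow_eq_zero_iff two_ne_zero |>.1
        (le_antisymm hsq (sq_nonneg _))))
  refine ⟨T, hconst, tendsto_nhds_unique ?_ hcluster⟩
  refine tendsto_const_nhds.congr' ?_
  filter_upwards [hφ.tendsto_atTop.eventually_ge_atTop T] with n hn
  exact (hconst _ hn).symm
end

section
/- (Corollary 1, case θ ∈ [1/2, 1): linear convergence rate.) Let D be a positive natural number and let Ψ : ℝ^D → ℝ (Euclidean space) be differentiable with continuous gradient ∇Ψ. Let (x^t)_{t∈ℕ} be a sequence and a > 0, b > 0 constants such that for all t: (H1) Ψ(x^{t+1}) + a‖x^{t+1} − x^t‖² ≤ Ψ(x^t), and (H2) ‖∇Ψ(x^{t+1})‖ ≤ b‖x^{t+1} − x^t‖. Suppose x* is a cluster point of (x^t), and Ψ satisfies the Kurdyka–Łojasiewicz inequality at x* with power desingularizer of exponent θ ∈ [1/2, 1): there exist K > 0, ε > 0 and η > 0 such that for all x with ‖x − x*‖ < ε and Ψ(x*) < Ψ(x) < Ψ(x*) + η, one has K·(Ψ(x) − Ψ(x*))^{θ−1}·‖∇Ψ(x)‖ ≥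 1. Then (x^t) converges to x* at a linear rate: there exist C > 0 and q ∈ (0,1) such that ‖x^t − x*‖ ≤ C·q^t for all t. -/
open Filter

/-- A sequence dominated by a geometric one from some index on is dominated by a multiple of it
everywhere. -/
theorem exists_le_mul_pow_of_shift {u : ℕ → ℝ} {c q : ℝ} (hu : ∀ t, 0 ≤ u t) (hq : 0 < q)
    (hc : 0 ≤ c) (T : ℕ) (h : ∀ n, u (T + n) ≤ c * q ^ n) :
    ∃ C, 0 < C ∧ ∀ t, u t ≤ C * q ^ t := by
  have hsum : 0 ≤ ∑ s ∈ Finset.range T, u s / q ^ s :=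
    Finset.sum_nonneg fun s _ => div_nonneg (hu s) (by positivity)
  have hcT : 0 ≤ c / q ^ T := by positivity
  refine ⟨∑ s ∈ Finset.range T, u s / q ^ s + c / q ^ T + 1, by positivity, fun t => ?_⟩
  rw [← div_le_iff₀ (by positivity)]
  rcases lt_or_ge t T with ht | ht
  · have := Finset.single_le_sum (f := fun s => u s / q ^ s)
      (fun s _ => div_nonneg (hu s) (by positivity)) (Finset.mem_range.2 ht)
    linarith
  · obtain ⟨n, rfl⟩ := Nat.exists_eq_add_of_le ht
    have : u (T + n) / q ^ (T + n) ≤ c / q ^ T := by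
      rw [div_le_div_iff₀ (by positivity) (by positivity), pow_add]
      calc u (T + n) * q ^ T ≤ c * q ^ n * q ^ T := by gcongr; exact h n
        _ = c * (q ^ T * q ^ n) := by ring
    linarith

/-- If the gaps `r t` contract by `σ ^ 2` as long as the iterates stay in the ball of radius `ε`
around `z`, and control the squared step lengths, then iterates starting close enough to `z` have
geometrically decreasing step lengths. -/
theorem dist_succ_le_geometric_of_local_contraction {E : Type*} [PseudoMetricSpace E] {x : ℕ → E}
    {z : E} {r : ℕ → ℝ} {a c σ ε : ℝ} (ha : 0 < a) (hc : 0 ≤ c) (hσ0 : 0 < σ) (hσ1 : σ < 1)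
    (hstep : ∀ t, a * dist (x t) (x (t + 1)) ^ 2 ≤ r t)
    (hcontr : ∀ t, dist (x (t + 1)) z < ε → r (t + 1) ≤ σ ^ 2 * r t)
    (h0 : r 0 ≤ a * c ^ 2) (hball : dist (x 0) z + c / (1 - σ) < ε) (n : ℕ) :
    dist (x n) (x (n + 1)) ≤ c * σ ^ n := by
  have hd : ∀ n, r n ≤ a * (c * σ ^ n) ^ 2 → dist (x n) (x (n + 1)) ≤ c * σ ^ n := by
    intro n hn
    refine (sq_le_sq₀ dist_nonneg (by positivity)).1 ?_
    exact le_of_mul_le_mul_left ((hstep n).trans hn) ha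
  have key : ∀ n, r n ≤ a * (c * σ ^ n) ^ 2 ∧
      dist (x 0) (x n) ≤ c / (1 - σ) * (1 - σ ^ n) := by
    intro n
    induction n with
    | zero => simpa using h0
    | succ n ih =>
      have h1 : 0 < 1 - σ := by linarith
      have hdist : dist (x 0) (x (n + 1)) ≤ c / (1 - σ) * (1 - σ ^ (n + 1)) := by
        calc dist (x 0) (x (n + 1)) ≤ dist (x 0) (x n) + dist (x n) (x (n + 1)) :=
              dist_triangle _ _ _
          _ ≤ c / (1 - σ) * (1 - σ ^ n) + c * σ ^ n := add_le_add ih.2 (hd n ih.1)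
          _ = c / (1 - σ) * (1 - σ ^ (n + 1)) := by field_simp; ring
      refine ⟨?_, hdist⟩
      have hle : c / (1 - σ) * (1 - σ ^ (n + 1)) ≤ c / (1 - σ) :=
        mul_le_of_le_one_right (by positivity) (by linarith [pow_pos hσ0 (n + 1)])
      have htri := dist_triangle_left (x (n + 1)) z (x 0)
      calc r (n + 1) ≤ σ ^ 2 * r n := hcontr n (by linarith)
        _ ≤ σ ^ 2 * (a * (c * σ ^ n) ^ 2) := by gcongr; exact ih.1
        _ = a * (c * σ ^ (n + 1)) ^ 2 := by ring
  exact hd n (key n).1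

/-- A power Kurdyka–Łojasiewicz bound with exponent at least `1 / 2` bounds a gap below `1` by the
squared gradient norm. -/
theorem le_sq_of_one_le_mul_rpow_mul {K r θ g : ℝ} (hK : 0 ≤ K) (hr0 : 0 < r) (hr1 : r ≤ 1)
    (hθ : 1 / 2 ≤ θ) (hg : 0 ≤ g) (h : 1 ≤ K * r ^ (θ - 1) * g) : r ≤ (K * g) ^ 2 := by
  have hpow : r ^ (θ - 1) ≤ (√r)⁻¹ := by
    rw [Real.sqrt_eq_rpow, ← Real.rpow_neg hr0.le]
    exact Real.rpow_le_rpow_of_exponent_ge hr0 hr1 (by linarith)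
  have hsqrt : 0 < √r := Real.sqrt_pos.2 hr0
  have : 1 ≤ K * g / √r := by
    calc (1 : ℝ) ≤ K * r ^ (θ - 1) * g := h
      _ ≤ K * (√r)⁻¹ * g := by gcongr
      _ = K * g / √r := by ring
  rw [le_div_iff₀ hsqrt, one_mul] at this
  exact (Real.sqrt_le_left (by positivity)).1 this

/-- Corollary 1, case `θ ∈ [1/2, 1)`: under (H1), (H2) and the KL inequality at a
cluster point `x*` with power desingularizer of exponent `θ ∈ [1/2, 1)`, the
sequence converges to `x*` at a linear rate. -/
theorem kl_linear_rate {D : ℕ} (hD : 0 < D)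
    (Ψ : EuclideanSpace ℝ (Fin D) → ℝ)
    (hdiff : Differentiable ℝ Ψ)
    (hgradcont : Continuous (gradient Ψ))
    (x : ℕ → EuclideanSpace ℝ (Fin D))
    (a b : ℝ) (ha : 0 < a) (hb : 0 < b)
    (H1 : ∀ t : ℕ, Ψ (x (t + 1)) + a * ‖x (t + 1) - x t‖ ^ 2 ≤ Ψ (x t))
    (H2 : ∀ t : ℕ, ‖gradient Ψ (x (t + 1))‖ ≤ b * ‖x (t + 1) - x t‖)
    (xstar : EuclideanSpace ℝ (Fin D))
    (φ : ℕ → ℕ) (hφ : StrictMono φ)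
    (hcluster : Tendsto (x ∘ φ) atTop (nhds xstar))
    (K θ ε η : ℝ) (hK : 0 < K) (hθ0 : 1 / 2 ≤ θ) (hθ1 : θ < 1) (hε : 0 < ε) (hη : 0 < η)
    (hKL : ∀ y : EuclideanSpace ℝ (Fin D), ‖y - xstar‖ < ε →
      Ψ xstar < Ψ y → Ψ y < Ψ xstar + η →
      1 ≤ K * (Ψ y - Ψ xstar) ^ (θ - 1) * ‖gradient Ψ y‖) :
    ∃ (C q : ℝ), 0 < C ∧ 0 < q ∧ q < 1 ∧
      ∀ t : ℕ, ‖x t - xstar‖ ≤ C * q ^ t := by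
  have hcont : Tendsto (fun k => Ψ (x (φ k)) - Ψ xstar) atTop (nhds 0) := by
    simpa using ((hdiff.continuous.tendsto xstar).comp hcluster).sub_const (Ψ xstar)
  have hanti : Antitone fun t => Ψ (x t) - Ψ xstar := antitone_nat_of_succ_le fun t => by
    have := H1 t
    have : 0 ≤ a * ‖x (t + 1) - x t‖ ^ 2 := by positivity
    linarith
  have hr0 : ∀ t, 0 ≤ Ψ (x t) - Ψ xstar := fun t =>
    le_of_tendsto hcont <| (hφ.tendsto_atTop.eventually_ge_atTop t).mono fun k hk => hanti hk
  set M : ℝ := (K * b) ^ 2 / a with hM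
  have hMpos : 0 < M := by positivity
  set σ : ℝ := √(M / (1 + M)) with hσ
  have hσ0 : 0 < σ := Real.sqrt_pos.2 (by positivity)
  have hσsq : σ ^ 2 = M / (1 + M) := Real.sq_sqrt (by positivity)
  have hσ1 : σ < 1 := by
    rw [hσ, Real.sqrt_lt' one_pos, one_pow, div_lt_one (by positivity)]
    linarith
  have hlim : Tendsto (fun k => dist (x (φ k)) xstar +
      √((Ψ (x (φ k)) - Ψ xstar) / a) / (1 - σ)) atTop (nhds 0) := by
    have h1 := tendsto_iff_dist_tendsto_zero.1 hcluster
    have h2 := ((hcont.div_const a).sqrt).div_const (1 - σ)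
    simpa using h1.add h2
  obtain ⟨k, hkε, hkη, hk1⟩ := ((hlim.eventually_lt_const hε).and
    ((hcont.eventually_lt_const hη).and (hcont.eventually_lt_const one_pos))).exists
  set T := φ k
  set c := √((Ψ (x T) - Ψ xstar) / a) with hc
  have hgeom : ∀ n, dist (x (T + n)) (x (T + n + 1)) ≤ c * σ ^ n := by
    refine dist_succ_le_geometric_of_local_contraction (x := fun n => x (T + n)) (z := xstar)
      (r := fun n => Ψ (x (T + n)) - Ψ xstar) ha (Real.sqrt_nonneg _) hσ0 hσ1
      (fun t => ?_) (fun t ht => ?_) ?_ hkε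
    · change a * dist (x (T + t)) (x (T + t + 1)) ^ 2 ≤ Ψ (x (T + t)) - Ψ xstar
      have h1 := H1 (T + t)
      have h2 := hr0 (T + t + 1)
      rw [dist_comm, dist_eq_norm]
      linarith
    · change Ψ (x (T + t + 1)) - Ψ xstar ≤ σ ^ 2 * (Ψ (x (T + t)) - Ψ xstar)
      rw [hσsq]
      rcases (hr0 (T + t + 1)).eq_or_lt with h0 | hpos
      · rw [← h0]
        exact mul_nonneg (by positivity) (hr0 _)
      have hle : Ψ (x (T + t + 1)) - Ψ xstar ≤ Ψ (x T) - Ψ xstar := hanti (by omega)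
      have hkl := hKL (x (T + t + 1)) (by rw [← dist_eq_norm]; exact ht) (by linarith)
        (by linarith)
      have h1 := le_sq_of_one_le_mul_rpow_mul hK.le hpos (by linarith) hθ0 (norm_nonneg _) hkl
      have h2 : Ψ (x (T + t + 1)) - Ψ xstar ≤ M * (a * ‖x (T + t + 1) - x (T + t)‖ ^ 2) := by
        calc _ ≤ _ := h1
          _ ≤ (K * (b * ‖x (T + t + 1) - x (T + t)‖)) ^ 2 := by gcongr; exact H2 _
          _ = _ := by rw [hM]; field_simp
      have h3 : M * (a * ‖x (T + t + 1) - x (T + t)‖ ^ 2) ≤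
          M * (Ψ (x (T + t)) - Ψ (x (T + t + 1))) :=
        mul_le_mul_of_nonneg_left (by linarith [H1 (T + t)]) hMpos.le
      rw [div_mul_eq_mul_div, le_div_iff₀ (by positivity)]
      linarith
    · rw [hc, Real.sq_sqrt (div_nonneg (hr0 T) ha.le)]
      exact (mul_div_cancel₀ _ ha.ne').ge
  obtain ⟨y, hy⟩ := cauchySeq_tendsto_of_complete (cauchySeq_of_le_geometric σ c hσ1 hgeom)
  have hxy : Tendsto x atTop (nhds y) := by
    rw [← tendsto_add_atTop_iff_nat T]
    simpa only [add_comm] using hy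
  obtain rfl : y = xstar := tendsto_nhds_unique (hxy.comp hφ.tendsto_atTop) hcluster
  obtain ⟨C, hC, hbound⟩ := exists_le_mul_pow_of_shift (u := fun t => ‖x t - y‖)
    (c := c / (1 - σ)) (fun _ => norm_nonneg _) hσ0
    (div_nonneg (Real.sqrt_nonneg _) (by linarith)) T fun n => by
      rw [← dist_eq_norm, div_mul_eq_mul_div]
      exact dist_le_of_le_geometric_of_tendsto σ c hσ1 hgeom hy n
  exact ⟨C, σ, hC, hσ0, hσ1, hbound⟩
end

section
/- (Corollary 1, case θ ∈ (0, 1/2): sublinear convergence rate.) Let D be a positive natural number and let Ψ : ℝ^D → ℝ (Euclidean space) be differentiable with continuous gradient ∇Ψ. Let (x^t)_{t∈ℕ} be a sequence and a > 0, b > 0 constants such that for all t: (H1) Ψ(x^{t+1}) + a‖x^{t+1} − x^t‖² ≤ Ψ(x^t), and (H2) ‖∇Ψ(x^{t+1})‖ ≤ b‖x^{t+1} − x^t‖. Suppose x* is a cluster point of (x^t), and Ψ satisfies the Kurdyka–Łojasiewicz inequality at x* with power desingularizer of exponent θ ∈ (0, 1/2): there exist K > 0, ε > 0 and η > 0 such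 that for all x with ‖x − x*‖ < ε and Ψ(x*) < Ψ(x) < Ψ(x*) + η, one has K·(Ψ(x) − Ψ(x*))^{θ−1}·‖∇Ψ(x)‖ ≥ 1. Then (x^t) converges to x* at a sublinear rate: there exists C > 0 such that ‖x^t − x*‖ ≤ C·t^{−θ/(1−2θ)} for all t ≥ 1. -/
open Filter

/-- The tangent-line bound `θ (u - v) ≤ (u ^ θ - v ^ θ) u ^ (1 - θ)` for the concave power. -/
lemma mul_sub_le_rpow_sub_rpow_mul {u v θ : ℝ} (hv : 0 ≤ v) (hu : 0 < u) (hθ0 : 0 ≤ θ)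
    (hθ1 : θ ≤ 1) : θ * (u - v) ≤ (u ^ θ - v ^ θ) * u ^ (1 - θ) := by
  have hdiv : 0 ≤ v / u := div_nonneg hv hu.le
  have hbern := rpow_one_add_le_one_add_mul_self (s := v / u - 1) (by linarith) hθ0 hθ1
  rw [add_sub_cancel, Real.div_rpow hv hu.le] at hbern
  have huθ : 0 < u ^ θ := Real.rpow_pos_of_pos hu θ
  have hsplit : u ^ θ * u ^ (1 - θ) = u := by
    rw [← Real.rpow_add hu, add_sub_cancel, Real.rpow_one]
  have hmul := mul_le_mul_of_nonneg_right hbern hu.le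
  have hleft : v ^ θ / u ^ θ * u = v ^ θ * u ^ (1 - θ) := by
    nth_rewrite 2 [← hsplit]
    field_simp
  have hright : (1 + θ * (v / u - 1)) * u = u + θ * (v - u) := by
    field_simp
  rw [hleft, hright] at hmul
  rw [sub_mul, hsplit]
  linarith

/-- A step whose length is controlled by the decrease from `u` to `v`, and which controls
`v ^ (1 - θ)`, is bounded by a multiple of the decrease of the power `θ`. -/
lemma exists_le_mul_rpow_sub_rpow {a B R θ : ℝ} (ha : 0 < a) (hB : 0 < B) (hR : 0 ≤ R)
    (hθ0 : 0 < θ) (hθ1 : θ < 1 / 2) :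
    ∃ C : ℝ, 0 < C ∧ ∀ u v d : ℝ, 0 ≤ v → v ≤ u → u ≤ R → 0 ≤ d → a * d ^ 2 ≤ u - v →
      (0 < v → v ^ (1 - θ) ≤ B * d) → d ≤ C * (u ^ θ - v ^ θ) := by
  have hS : 0 ≤ √(R ^ (1 - 2 * θ) / a) := Real.sqrt_nonneg _
  set S := √(R ^ (1 - 2 * θ) / a) with hS_def
  refine ⟨2 * B / (a * θ) + 2 / θ * S, by positivity, fun u v d hv hvu huR hd had hKL => ?_⟩
  have hdiff : 0 ≤ u ^ θ - v ^ θ := sub_nonneg.2 (Real.rpow_le_rpow hv hvu hθ0.le)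
  rcases hd.eq_or_lt with rfl | hd
  · positivity
  have hu : 0 < u := by nlinarith [mul_pos ha (pow_pos hd 2)]
  have htan := mul_sub_le_rpow_sub_rpow_mul hv hu hθ0.le (by linarith : θ ≤ 1)
  rw [add_mul]
  rcases le_or_gt u (2 * v) with huv | huv
  · have hu1 : u ^ (1 - θ) ≤ 2 * (B * d) := by
      calc u ^ (1 - θ) ≤ (2 * v) ^ (1 - θ) := Real.rpow_le_rpow hu.le huv (by linarith)
        _ = 2 ^ (1 - θ) * v ^ (1 - θ) := Real.mul_rpow (by norm_num) hv
        _ ≤ 2 * (B * d) := by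
          gcongr
          · exact (Real.rpow_le_rpow_of_exponent_le (by norm_num) (by linarith)).trans_eq
              (Real.rpow_one 2)
          · exact hKL (by linarith)
    have hbound : a * θ * d ≤ 2 * B * (u ^ θ - v ^ θ) := by
      refine le_of_mul_le_mul_right ?_ hd
      nlinarith [mul_le_mul_of_nonneg_left hu1 hdiff, mul_le_mul_of_nonneg_left had hθ0.le]
    have hmain : d ≤ 2 * B / (a * θ) * (u ^ θ - v ^ θ) := by
      rw [div_mul_eq_mul_div, le_div_iff₀ (by positivity)]
      linarith
    have : 0 ≤ 2 / θ * S * (u ^ θ - v ^ θ) := by positivity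
    linarith
  · have hsplit : u ^ θ * u ^ (1 - θ) = u := by
      rw [← Real.rpow_add hu, add_sub_cancel, Real.rpow_one]
    have hsplit' : (u ^ θ) ^ 2 * u ^ (1 - 2 * θ) = u := by
      rw [← Real.rpow_natCast, ← Real.rpow_mul hu.le, ← Real.rpow_add hu]
      simp [mul_comm θ 2]
    have huθ : θ / 2 * u ^ θ ≤ u ^ θ - v ^ θ := by
      refine le_of_mul_le_mul_right ?_ (Real.rpow_pos_of_pos hu (1 - θ))
      nlinarith
    have hdS : d ≤ S * u ^ θ := by
      refine le_of_sq_le_sq ?_ (by positivity)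
      rw [mul_pow, hS_def, Real.sq_sqrt (by positivity), div_mul_eq_mul_div, le_div_iff₀ ha]
      have := Real.rpow_le_rpow hu.le huR (by linarith : 0 ≤ 1 - 2 * θ)
      nlinarith [mul_le_mul_of_nonneg_left this (sq_nonneg (u ^ θ))]
    have hmain : d ≤ 2 / θ * S * (u ^ θ - v ^ θ) := by
      calc d ≤ S * u ^ θ := hdS
        _ = 2 / θ * S * (θ / 2 * u ^ θ) := by field_simp
        _ ≤ _ := by gcongr
    have : 0 ≤ 2 * B / (a * θ) * (u ^ θ - v ^ θ) := by positivity
    linarith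

/-- A decrease by at least `m v ^ (1 + p)` makes the inverse power `u ^ (-p)` grow by a fixed
amount; the conclusion is this fact with denominators cleared. -/
lemma rpow_add_mul_le_rpow {m p u v R : ℝ} (hm : 0 < m) (hp0 : 0 < p) (hp1 : p ≤ 1)
    (hv : 0 ≤ v) (hvu : v ≤ u) (huR : u ≤ R) (h : m * v ^ (1 + p) ≤ u - v) :
    v ^ p + p * m / (1 + m * R ^ p) * (v ^ p * u ^ p) ≤ u ^ p := by
  rcases hv.eq_or_lt with rfl | hv
  · simp [Real.zero_rpow hp0.ne', Real.rpow_nonneg hvu]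
  have hu : 0 < u := hv.trans_le hvu
  have hV : 0 < v ^ p := Real.rpow_pos_of_pos hv p
  have hU : 0 < u ^ p := Real.rpow_pos_of_pos hu p
  have hVR : v ^ p ≤ R ^ p := Real.rpow_le_rpow hv.le (hvu.trans huR) hp0.le
  rw [Real.rpow_add hv, Real.rpow_one] at h
  set z := m * v ^ p with hz_def
  have hz : 0 < z := by positivity
  have hvu' : v / u ≤ 1 + -(z / (1 + z)) := by
    rw [show 1 + -(z / (1 + z)) = 1 / (1 + z) by field_simp; ring,
      div_le_div_iff₀ hu (by positivity)]
    nlinarith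
  have hbern := rpow_one_add_le_one_add_mul_self (s := -(z / (1 + z)))
    (by linarith [div_nonneg hv.le hu.le]) hp0.le hp1
  have hratio := (Real.rpow_le_rpow (by positivity) hvu' hp0.le).trans hbern
  rw [Real.div_rpow hv.le hu.le, div_le_iff₀ hU] at hratio
  have hcoef : p * m / (1 + m * R ^ p) * v ^ p ≤ p * (z / (1 + z)) := by
    calc p * m / (1 + m * R ^ p) * v ^ p ≤ p * m / (1 + m * v ^ p) * v ^ p := by gcongr
      _ = p * (z / (1 + z)) := by rw [hz_def]; ring
  nlinarith [mul_le_mul_of_nonneg_right hcoef hU.le]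

/-- Nonnegative sequences satisfying `w (n + 1) + μ w (n + 1) w n ≤ w n` decay like `1 / n`. -/
lemma mul_mul_le_one_of_add_mul_le {w : ℕ → ℝ} {μ : ℝ} (hw : ∀ n, 0 ≤ w n)
    (h : ∀ n, w (n + 1) + μ * (w (n + 1) * w n) ≤ w n) (n : ℕ) : μ * n * w n ≤ 1 := by
  induction n with
  | zero => simp
  | succ n ih =>
    have hstep := h n
    rcases (hw n).eq_or_lt with hn | hn
    · have : w (n + 1) = 0 := by
        rw [← hn] at hstep
        exact le_antisymm (by linarith) (hw _)
      simp [this]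
    · refine le_of_mul_le_mul_right ?_ hn
      push_cast
      nlinarith [mul_le_mul_of_nonneg_left ih (hw (n + 1))]

/-- Corollary 1, case `θ ∈ (0, 1/2)`: under (H1), (H2) and the KL inequality at a
cluster point `x*` with power desingularizer of exponent `θ ∈ (0, 1/2)`, the
sequence converges to `x*` at the sublinear rate `O(t^{−θ/(1−2θ)})`. -/
theorem kl_sublinear_rate {D : ℕ} (hD : 0 < D)
    (Ψ : EuclideanSpace ℝ (Fin D) → ℝ)
    (hdiff : Differentiable ℝ Ψ)
    (hgradcont : Continuous (gradient Ψ))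
    (x : ℕ → EuclideanSpace ℝ (Fin D))
    (a b : ℝ) (ha : 0 < a) (hb : 0 < b)
    (H1 : ∀ t : ℕ, Ψ (x (t + 1)) + a * ‖x (t + 1) - x t‖ ^ 2 ≤ Ψ (x t))
    (H2 : ∀ t : ℕ, ‖gradient Ψ (x (t + 1))‖ ≤ b * ‖x (t + 1) - x t‖)
    (xstar : EuclideanSpace ℝ (Fin D))
    (φ : ℕ → ℕ) (hφ : StrictMono φ)
    (hcluster : Tendsto (x ∘ φ) atTop (nhds xstar))
    (K θ ε η : ℝ) (hK : 0 < K) (hθ0 : 0 < θ) (hθ1 : θ < 1 / 2) (hε : 0 < ε) (hη : 0 < η)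
    (hKL : ∀ y : EuclideanSpace ℝ (Fin D), ‖y - xstar‖ < ε →
      Ψ xstar < Ψ y → Ψ y < Ψ xstar + η →
      1 ≤ K * (Ψ y - Ψ xstar) ^ (θ - 1) * ‖gradient Ψ y‖) :
    ∃ C : ℝ, 0 < C ∧
      ∀ t : ℕ, 1 ≤ t → ‖x t - xstar‖ ≤ C * (t : ℝ) ^ (-(θ / (1 - 2 * θ))) := by
  set r : ℕ → ℝ := fun t => Ψ (x t) - Ψ xstar with hr_def
  have hstep : ∀ t, a * ‖x (t + 1) - x t‖ ^ 2 ≤ r t - r (t + 1) := fun t => by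
    simp only [hr_def]; linarith [H1 t]
  have hanti : Antitone r := antitone_nat_of_succ_le fun t => by
    have : 0 ≤ a * ‖x (t + 1) - x t‖ ^ 2 := by positivity
    linarith [hstep t]
  have hrφ : Tendsto (r ∘ φ) atTop (nhds 0) := by
    have h := ((hdiff.continuous.tendsto xstar).comp hcluster).sub_const (Ψ xstar)
    rwa [sub_self] at h
  have hr : Tendsto r atTop (nhds 0) :=
    (tendsto_iff_tendsto_subseq_of_antitone hanti hφ.tendsto_atTop).2 hrφ
  have hr0 : ∀ t, 0 ≤ r t := fun t => hanti.le_of_tendsto hr t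
  have hgrad : ∀ t, ‖x (t + 1) - xstar‖ < ε → r t < η → 0 < r (t + 1) →
      r (t + 1) ^ (1 - θ) ≤ K * b * ‖x (t + 1) - x t‖ := fun t hball hrη hpos => by
    have hlt : r (t + 1) < η := (hanti t.le_succ).trans_lt hrη
    have hkl := hKL (x (t + 1)) hball (sub_pos.1 hpos) (by simp only [hr_def] at hlt; linarith)
    have hinv : r (t + 1) ^ (1 - θ) * r (t + 1) ^ (θ - 1) = 1 := by
      rw [← Real.rpow_add hpos]; simp
    have hP : 0 < r (t + 1) ^ (1 - θ) := Real.rpow_pos_of_pos hpos _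
    calc r (t + 1) ^ (1 - θ)
        ≤ r (t + 1) ^ (1 - θ) * (K * r (t + 1) ^ (θ - 1) * ‖gradient Ψ (x (t + 1))‖) :=
          le_mul_of_one_le_right hP.le hkl
      _ = (r (t + 1) ^ (1 - θ) * r (t + 1) ^ (θ - 1)) * (K * ‖gradient Ψ (x (t + 1))‖) := by ring
      _ = K * ‖gradient Ψ (x (t + 1))‖ := by rw [hinv, one_mul]
      _ ≤ K * (b * ‖x (t + 1) - x t‖) := by gcongr; exact H2 t
      _ = K * b * ‖x (t + 1) - x t‖ := by ring
  obtain ⟨C, hC, hCstep⟩ := exists_le_mul_rpow_sub_rpow ha (mul_pos hK hb) (hr0 0) hθ0 hθ1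
  have hlen : ∀ t, ‖x (t + 1) - xstar‖ < ε → r t < η →
      ‖x (t + 1) - x t‖ ≤ C * (r t ^ θ - r (t + 1) ^ θ) := fun t hball hrη =>
    hCstep _ _ _ (hr0 _) (hanti t.le_succ) (hanti t.zero_le) (norm_nonneg _) (hstep t)
      (hgrad t hball hrη)
  -- A time after which the iterates stay in the region where the KL inequality holds.
  have hrθ : Tendsto (fun t => C * r t ^ θ) atTop (nhds 0) := by
    have h := (hr.rpow_const (Or.inr hθ0.le)).const_mul C
    rwa [Real.zero_rpow hθ0.ne', mul_zero] at h
  have hnear : ∀ᶠ n in atTop, ‖x (φ n) - xstar‖ + C * r (φ n) ^ θ < ε / 2 := by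
    have h := (tendsto_iff_norm_sub_tendsto_zero.1 hcluster).add (hrθ.comp hφ.tendsto_atTop)
    rw [add_zero] at h
    exact h.eventually_lt_const (by positivity)
  obtain ⟨n₀, hT, hTη, hTε⟩ := (hnear.and ((hrφ.eventually_lt_const hη).and
    (hrφ.eventually_lt_const (show 0 < a * (ε / 2) ^ 2 by positivity)))).exists
  set T := φ n₀
  have hjump : ∀ t, T ≤ t → ‖x (t + 1) - x t‖ < ε / 2 := fun t ht => by
    refine lt_of_pow_lt_pow_left₀ 2 (by positivity) (lt_of_mul_lt_mul_left ?_ ha.le)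
    have : r t ≤ r T := hanti ht
    have hTε' : r T < a * (ε / 2) ^ 2 := hTε
    linarith [hstep t, hr0 (t + 1)]
  have hηt : ∀ t, T ≤ t → r t < η := fun t ht => (hanti ht).trans_lt hTη
  have htri : ∀ t, ‖x (t + 1) - xstar‖ ≤ ‖x (t + 1) - x t‖ + ‖x t - xstar‖ := fun t =>
    norm_sub_le_norm_sub_add_norm_sub _ _ _
  have hstay : ∀ t, T ≤ t → ‖x t - xstar‖ + C * r t ^ θ < ε / 2 := fun t ht => by
    induction t, ht using Nat.le_induction with
    | base => exact hT
    | succ t ht ih =>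
      have hpos : 0 ≤ C * r t ^ θ := mul_nonneg hC.le (Real.rpow_nonneg (hr0 t) θ)
      have := hlen t (by linarith [htri t, hjump t ht]) (hηt t ht)
      linarith [htri t]
  have hball : ∀ t, T ≤ t → ‖x (t + 1) - xstar‖ < ε := fun t ht => by
    have hpos : 0 ≤ C * r t ^ θ := mul_nonneg hC.le (Real.rpow_nonneg (hr0 t) θ)
    linarith [htri t, hjump t ht, hstay t ht]
  have hdist : ∀ t, T ≤ t → ‖x t - xstar‖ ≤ C * r t ^ θ := fun t ht => by
    have htele : ∀ s, t ≤ s → ‖x t - x s‖ ≤ C * r t ^ θ := fun s hs => by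
      suffices h : ‖x t - x s‖ + C * r s ^ θ ≤ C * r t ^ θ by
        have hpos : 0 ≤ C * r s ^ θ := mul_nonneg hC.le (Real.rpow_nonneg (hr0 s) θ)
        linarith
      induction s, hs using Nat.le_induction with
      | base => simp
      | succ s hs ih =>
        have h1 := hlen s (hball s (ht.trans hs)) (hηt s (ht.trans hs))
        have h2 := norm_sub_le_norm_sub_add_norm_sub (x t) (x s) (x (s + 1))
        rw [norm_sub_rev (x s)] at h2
        linarith
    refine le_of_tendsto (hcluster.const_sub (x t)).norm ?_
    filter_upwards [hφ.tendsto_atTop.eventually_ge_atTop t] with n hn using htele _ hn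
  -- The decay rate of the function values.
  have hp : 0 < 1 - 2 * θ := by linarith
  set p := 1 - 2 * θ
  set m := a / (K * b) ^ 2 with hm_def
  have hm : 0 < m := by positivity
  set μ := p * m / (1 + m * r 0 ^ p)
  have hμ : 0 < μ := by have := Real.rpow_nonneg (hr0 0) p; positivity
  have hdecr : ∀ t, T ≤ t → r (t + 1) ^ p + μ * (r (t + 1) ^ p * r t ^ p) ≤ r t ^ p :=
    fun t ht => by
    refine rpow_add_mul_le_rpow hm hp (by linarith) (hr0 _) (hanti t.le_succ)
      (hanti t.zero_le) ?_
    rcases (hr0 (t + 1)).eq_or_lt with h0 | hpos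
    · rw [← h0, Real.zero_rpow (by linarith), mul_zero, sub_zero]
      exact hr0 t
    · have hsq : r (t + 1) ^ (1 + p) = (r (t + 1) ^ (1 - θ)) ^ 2 := by
        rw [← Real.rpow_natCast, ← Real.rpow_mul (hr0 _)]
        congr 1
        push_cast
        linarith
      calc m * r (t + 1) ^ (1 + p) ≤ m * (K * b * ‖x (t + 1) - x t‖) ^ 2 := by
            rw [hsq]
            have := hgrad t (hball t ht) (hηt t ht) hpos
            have := Real.rpow_nonneg (hr0 (t + 1)) (1 - θ)
            gcongr
        _ = a * ‖x (t + 1) - x t‖ ^ 2 := by rw [hm_def]; field_simp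
        _ ≤ _ := hstep t
  have hrate : ∀ n : ℕ, μ * n * r (T + n) ^ p ≤ 1 :=
    mul_mul_le_one_of_add_mul_le (w := fun n => r (T + n) ^ p)
      (fun n => Real.rpow_nonneg (hr0 _) p) fun n => hdecr (T + n) (Nat.le_add_right T n)
  have hO : (fun t => x t - xstar) =O[atTop] fun t : ℕ => (t : ℝ) ^ (-(θ / p)) := by
    refine Asymptotics.IsBigO.of_bound (C * (2 / μ) ^ (θ / p)) ?_
    filter_upwards [eventually_ge_atTop (2 * T + 1)] with t ht
    have ht0 : (0 : ℝ) < t := by exact_mod_cast (by omega : 0 < t)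
    obtain ⟨n, rfl⟩ := Nat.exists_eq_add_of_le (by omega : T ≤ t)
    have hn : ((T + n : ℕ) : ℝ) ≤ 2 * n := by exact_mod_cast (by omega : T + n ≤ 2 * n)
    have hw : 0 ≤ r (T + n) ^ p := Real.rpow_nonneg (hr0 _) p
    have hval : r (T + n) ^ p ≤ 2 / μ * ((T + n : ℕ) : ℝ)⁻¹ := by
      rw [← div_eq_mul_inv, div_div, le_div_iff₀ (by positivity)]
      nlinarith [hrate n, mul_le_mul_of_nonneg_left hn (mul_nonneg hμ.le hw)]
    rw [Real.norm_of_nonneg (by positivity), mul_assoc]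
    calc ‖x (T + n) - xstar‖ ≤ C * r (T + n) ^ θ := hdist _ (Nat.le_add_right T n)
      _ = C * (r (T + n) ^ p) ^ (θ / p) := by
        rw [← Real.rpow_mul (hr0 _), mul_div_cancel₀ _ hp.ne']
      _ ≤ C * (2 / μ * ((T + n : ℕ) : ℝ)⁻¹) ^ (θ / p) := by gcongr
      _ = _ := by
        rw [Real.mul_rpow (by positivity) (by positivity), Real.inv_rpow ht0.le,
          Real.rpow_neg ht0.le]
  obtain ⟨C', hC', hbound⟩ := Asymptotics.bound_of_isBigO_nat_atTop hO
  refine ⟨C', hC', fun t ht => ?_⟩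
  have ht0 : (0 : ℝ) < t := by exact_mod_cast ht
  have hpow := Real.rpow_pos_of_pos ht0 (-(θ / p))
  simpa only [Real.norm_of_nonneg hpow.le] using hbound hpow.ne'
end
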